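/- Let H be a complex Hilbert space, N a von Neumann algebra on H with commutant N', C a unital C*-algebra, and u : C → B(H) a unital bounded algebra homomorphism with u(C) ⊆ N. Suppose T ∈ B(H) is invertible, the map x ↦ T u(x) T⁻¹ is a *-homomorphism on C, and (T y T⁻¹)* = T y* T⁻¹ for every y ∈ N'. Then |T| := √(T*T) belongs to N, is invertible with |T|⁻¹ ∈ N, the map x ↦ |T| u(x) |T|⁻¹ is a *-homomorphism, and moreover ‖|T|‖ = ‖T‖ and ‖|T|⁻¹‖ = ‖T⁻¹‖. -/

import Mathlib

open ContinuousLinearMap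

/-- Conjugation by a unit `t` intertwines `star` on `y` with `z` precisely when
`star t * t` intertwines `star y` and `z`. -/
theorem Units.star_conj_eq_iff {A : Type*} [Monoid A] [StarMul A] (t : Aˣ) (y z : A) :
    star ((t : A) * y * (↑t⁻¹ : A)) = t * z * (↑t⁻¹ : A) ↔
      star y * (star (t : A) * t) = star (t : A) * t * z := by
  rw [Units.eq_mul_inv_iff_mul_eq, ← (star t).mul_right_inj]
  simp only [star_mul, Units.coe_star, ← mul_assoc]
  rw [← star_mul, Units.inv_mul, star_one, one_mul]

/-- Elements with the same `star t * t` have the same norm. -/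
theorem CStarRing.norm_eq_of_star_mul_self_eq {A : Type*} [NonUnitalNormedRing A] [StarRing A]
    [CStarRing A] {s t : A} (h : star s * s = star t * t) : ‖s‖ = ‖t‖ := by
  rw [← mul_self_inj (norm_nonneg _) (norm_nonneg _), ← CStarRing.norm_star_mul_self,
    ← CStarRing.norm_star_mul_self, h]

/-- Units with the same `star t * t` have inverses of the same norm. -/
theorem Units.norm_inv_eq_of_star_mul_self_eq {A : Type*} [NormedRing A] [StarRing A]
    [CStarRing A] {s t : Aˣ} (h : star (s : A) * s = star (t : A) * t) :
    ‖(↑s⁻¹ : A)‖ = ‖(↑t⁻¹ : A)‖ := by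
  have h' : star s * s = star t * t := Units.ext (by simpa using h)
  have h'' : s⁻¹ * star s⁻¹ = t⁻¹ * star t⁻¹ := by
    rw [star_inv, star_inv, ← mul_inv_rev, ← mul_inv_rev, h']
  rw [← mul_self_inj (norm_nonneg _) (norm_nonneg _), ← CStarRing.norm_self_mul_star,
    ← CStarRing.norm_self_mul_star]
  exact congrArg (fun x : Aˣ => ‖(x : A)‖) h''

/-- A von Neumann algebra contains the inverses of its invertible elements. -/
theorem VonNeumannAlgebra.units_inv_mem {H : Type*} [NormedAddCommGroup H]
    [InnerProductSpace ℂ H] [CompleteSpace H] (N : VonNeumannAlgebra H) {s : (H →L[ℂ] H)ˣ}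
    (hs : (s : H →L[ℂ] H) ∈ N) : (↑s⁻¹ : H →L[ℂ] H) ∈ N := by
  rw [← N.commutant_commutant, VonNeumannAlgebra.mem_commutant_iff]
  intro g hg
  have hgs : Commute g s := (VonNeumannAlgebra.mem_commutant_iff.1 hg _ hs).symm
  exact hgs.units_inv_right

/-- A von Neumann algebra is closed under square roots. -/
theorem VonNeumannAlgebra.sqrt_mem {H : Type*} [NormedAddCommGroup H]
    [InnerProductSpace ℂ H] [CompleteSpace H] (N : VonNeumannAlgebra H) {a : H →L[ℂ] H}
    (ha : a ∈ N) : CFC.sqrt a ∈ N := by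
  rw [← N.commutant_commutant, VonNeumannAlgebra.mem_commutant_iff]
  intro g hg
  have hag : Commute a g := VonNeumannAlgebra.mem_commutant_iff.1 hg _ ha
  exact (hag.cfcₙ_nnreal _).symm

/-- If `u : C → B(H)` is a unital bounded homomorphism into a von Neumann algebra `N`,
`T` is invertible, `x ↦ T u(x) T⁻¹` is a `*`-homomorphism and conjugation by `T` is a
`*`-map on `N'`, then `|T| = √(T*T)` lies in `N`, is invertible with inverse in `N`,
`x ↦ |T| u(x) |T|⁻¹` is a `*`-homomorphism, and `‖|T|‖ = ‖T‖`, `‖|T|⁻¹‖ = ‖T⁻¹‖`. -/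
theorem stmt2 {H : Type*} [NormedAddCommGroup H] [InnerProductSpace ℂ H] [CompleteSpace H]
    {C : Type*} [CStarAlgebra C]
    (N : VonNeumannAlgebra H) (u : C →ₐ[ℂ] (H →L[ℂ] H)) (hu : Continuous u)
    (huN : ∀ x, u x ∈ N)
    (T : (H →L[ℂ] H)ˣ)
    (hhom : ∀ x : C,
      adjoint ((T : H →L[ℂ] H) * u x * (↑T⁻¹ : H →L[ℂ] H)) =
        (T : H →L[ℂ] H) * u (star x) * (↑T⁻¹ : H →L[ℂ] H))
    (hstar : ∀ y : H →L[ℂ] H, y ∈ N.commutant →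
      adjoint ((T : H →L[ℂ] H) * y * (↑T⁻¹ : H →L[ℂ] H)) =
        (T : H →L[ℂ] H) * adjoint y * (↑T⁻¹ : H →L[ℂ] H)) :
    IsUnit (CFC.sqrt (adjoint (T : H →L[ℂ] H) * (T : H →L[ℂ] H))) ∧
    CFC.sqrt (adjoint (T : H →L[ℂ] H) * (T : H →L[ℂ] H)) ∈ N ∧
    Ring.inverse (CFC.sqrt (adjoint (T : H →L[ℂ] H) * (T : H →L[ℂ] H))) ∈ N ∧
    (∀ x : C,
      adjoint (CFC.sqrt (adjoint (T : H →L[ℂ] H) * (T : H →L[ℂ] H)) * u x *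
          Ring.inverse (CFC.sqrt (adjoint (T : H →L[ℂ] H) * (T : H →L[ℂ] H)))) =
        CFC.sqrt (adjoint (T : H →L[ℂ] H) * (T : H →L[ℂ] H)) * u (star x) *
          Ring.inverse (CFC.sqrt (adjoint (T : H →L[ℂ] H) * (T : H →L[ℂ] H)))) ∧
    ‖CFC.sqrt (adjoint (T : H →L[ℂ] H) * (T : H →L[ℂ] H))‖ = ‖(T : H →L[ℂ] H)‖ ∧
    ‖Ring.inverse (CFC.sqrt (adjoint (T : H →L[ℂ] H) * (T : H →L[ℂ] H)))‖ =
      ‖(↑T⁻¹ : H →L[ℂ] H)‖ := by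
  simp only [← star_eq_adjoint] at hhom hstar ⊢
  have h0 : 0 ≤ star (T : H →L[ℂ] H) * T := star_mul_self_nonneg _
  have hU : IsUnit (CFC.sqrt (star (T : H →L[ℂ] H) * T)) :=
    (CFC.isUnit_sqrt_iff _ h0).2 (T.isUnit.star.mul T.isUnit)
  have hTN : star (T : H →L[ℂ] H) * T ∈ N := by
    rw [← N.commutant_commutant, VonNeumannAlgebra.mem_commutant_iff]
    intro y hy
    have hy' := hstar (star y) (star_mem hy)
    rwa [Units.star_conj_eq_iff, star_star] at hy'
  have hSN := N.sqrt_mem hTN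
  obtain ⟨S, hS⟩ := hU
  have hSS : star (S : H →L[ℂ] H) * S = star (T : H →L[ℂ] H) * T := by
    rw [hS, (CFC.sqrt_nonneg _).isSelfAdjoint.star_eq, CFC.sqrt_mul_sqrt_self _ h0]
  rw [← hS] at hSN ⊢
  rw [Ring.inverse_unit]
  refine ⟨S.isUnit, hSN, N.units_inv_mem hSN, fun x => ?_,
    CStarRing.norm_eq_of_star_mul_self_eq hSS, Units.norm_inv_eq_of_star_mul_self_eq hSS⟩
  have hx := hhom x
  rw [Units.star_conj_eq_iff] at hx ⊢
  rwa [hSS]
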